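/- Suppose that for every positive integer t, every graph G with no K_{t+1}-minor satisfies χ(G[N_G[v]]) ≤ t for every vertex v ∈ V(G). Then for every positive integer t, every graph with no K_{t+1}-minor has chromatic number at most t (i.e. Hadwiger's conjecture holds). -/

import Mathlib

open SimpleGraph

/-- The chromatic number of a graph, as a natural number. -/
noncomputable def chromNat {V : Type} (G : SimpleGraph V) : ℕ :=
  sInf {k : ℕ | G.Colorable k}

/-- `H` is a minor of `G`: there is a family of branch sets in `G`, one for each
vertex of `H`, which are connected, pairwise disjoint, and joined by an edge of `G`
whenever the corresponding vertices are adjacent in `H`. -/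
def HasMinor {V W : Type} (G : SimpleGraph V) (H : SimpleGraph W) : Prop :=
  ∃ b : W → Set V,
    (∀ w, (G.induce (b w)).Connected) ∧
    (Pairwise fun w₁ w₂ => Disjoint (b w₁) (b w₂)) ∧
    (∀ ⦃w₁ w₂ : W⦄, H.Adj w₁ w₂ → ∃ u ∈ b w₁, ∃ v ∈ b w₂, G.Adj u v)

/-- The graph obtained from `G` by adding a universal vertex `none`. -/
def coneGraph {V : Type} (G : SimpleGraph V) : SimpleGraph (Option V) where
  Adj
    | some u, some v => G.Adj u v
    | none, some _ => True
    | some _, none => True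
    | none, none => False
  symm := ⟨by
    rintro (_ | u) (_ | v) huv
    exacts [huv, trivial, trivial, G.adj_symm huv]⟩
  loopless := ⟨by
    rintro (_ | u) huu
    exacts [huu, G.loopless.irrefl u huu]⟩

/-- A set of vertices of the cone avoiding the apex induces the same graph as in the base. -/
noncomputable def induceConeIso {V : Type} (G : SimpleGraph V) (B : Set (Option V)) (hB : none ∉ B) :
    G.induce (some ⁻¹' B) ≃g (coneGraph G).induce B where
  toEquiv := Equiv.ofBijective (fun x => ⟨some x.1, x.2⟩) <| by
    refine ⟨fun x y hxy => Subtype.ext (Option.some.inj (congrArg Subtype.val hxy)), ?_⟩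
    rintro ⟨_ | v, hv⟩
    exacts [absurd hv hB, ⟨⟨v, hv⟩, rfl⟩]
  map_rel_iff' := Iff.rfl

theorem HasMinor.of_coneGraph {V : Type} {G : SimpleGraph V} {n : ℕ}
    (hG : HasMinor (coneGraph G) (⊤ : SimpleGraph (Fin (n + 1)))) :
    HasMinor G (⊤ : SimpleGraph (Fin n)) := by
  obtain ⟨b, hconn, hdisj, hadj⟩ := hG
  obtain ⟨i, hi⟩ : ∃ i, ∀ j, j ≠ i → none ∉ b j := by
    by_cases hex : ∃ i, none ∈ b i
    · obtain ⟨i, hi⟩ := hex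
      exact ⟨i, fun j hji hj => Set.disjoint_left.1 (hdisj hji) hj hi⟩
    · exact ⟨0, fun j _ hj => hex ⟨j, hj⟩⟩
  have hb (k : Fin n) : none ∉ b (i.succAbove k) := hi _ (Fin.succAbove_ne i k)
  refine ⟨fun k => some ⁻¹' b (i.succAbove k), fun k => ?_, fun k l hkl => ?_, fun k l hkl => ?_⟩
  · exact (induceConeIso G _ (hb k)).connected_iff.2 (hconn _)
  · exact (hdisj (Fin.succAbove_right_injective.ne hkl)).preimage some
  · obtain ⟨u, hu, v, hv, huv⟩ := @hadj (i.succAbove k) (i.succAbove l)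
      (Fin.succAbove_right_injective.ne hkl)
    rcases u with _ | u
    · exact absurd hu (hb k)
    rcases v with _ | v
    · exact absurd hv (hb l)
    exact ⟨u, hu, v, hv, huv⟩

theorem colorable_of_chromNat_le {V : Type} [Finite V] {G : SimpleGraph V} {n : ℕ}
    (hn : chromNat G ≤ n) : G.Colorable n := by
  have := Fintype.ofFinite V
  exact (Nat.sInf_mem (s := {k : ℕ | G.Colorable k}) ⟨_, G.colorable_of_fintype⟩).mono hn

theorem colorable_of_coneGraph {V : Type} {G : SimpleGraph V} {n : ℕ}
    (hG : ((coneGraph G).induce ((coneGraph G).neighborSet none ∪ {none})).Colorable (n + 1)) :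
    G.Colorable n := by
  obtain ⟨c⟩ := hG
  let apex : ↥((coneGraph G).neighborSet none ∪ {none}) := ⟨none, Or.inr rfl⟩
  let base (v : V) : ↥((coneGraph G).neighborSet none ∪ {none}) := ⟨some v, Or.inl trivial⟩
  have hne (v : V) : c (base v) ≠ c apex := c.valid (v := base v) (w := apex) trivial
  let c' : G.Coloring {x : Fin (n + 1) // x ≠ c apex} :=
    Coloring.mk (fun v => ⟨c (base v), hne v⟩) fun {u v} huv heq =>
      c.valid (v := base u) (w := base v) huv (congrArg Subtype.val heq)
  simpa using c'.colorable

/-- If for every positive integer `t`, every graph `G` with no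
`K_{t+1}`-minor satisfies `χ(G[N_G[v]]) ≤ t` for every vertex `v`, then every graph
with no `K_{t+1}`-minor has chromatic number at most `t` (Hadwiger's conjecture). -/
theorem stmt9
    (h : ∀ (t : ℕ), 0 < t → ∀ (V : Type) [Fintype V] (G : SimpleGraph V),
      ¬ HasMinor G (⊤ : SimpleGraph (Fin (t + 1))) →
        ∀ v : V, chromNat (G.induce (G.neighborSet v ∪ {v})) ≤ t) :
    ∀ (t : ℕ), 0 < t → ∀ (V : Type) [Fintype V] (G : SimpleGraph V),
      ¬ HasMinor G (⊤ : SimpleGraph (Fin (t + 1))) → chromNat G ≤ t := by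
  intro t _ V _ G hG
  have hcone := h (t + 1) t.succ_pos (Option V) (coneGraph G) (fun hm => hG hm.of_coneGraph) none
  exact Nat.sInf_le (colorable_of_coneGraph (colorable_of_chromNat_le hcone))
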